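/- For all integers 1 ≤ n ≤ m and Z ∈ {X,Y}, the two-colored quantum binomial coefficients satisfy [m choose n]_Z = [m+1 choose n]_{σⁿ(Z)}·[n+1]_Z − [m choose n−1]_Z·[m+2]_{σ^{n+1}(Z)} in ℤ[X,Y]. -/

import Mathlib

/-- The polynomial ring `ℤ[X,Y]`, with the variable `X` indexed by `true` and
the variable `Y` indexed by `false`. -/
noncomputable abbrev TCQ.R₀ : Type := MvPolynomial Bool ℤ

/-- The two-colored quantum numbers `[n]_X, [n]_Y ∈ ℤ[X,Y]`.  The color `Z ∈ {X,Y}` is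
encoded as a `Bool` (`true` for `X`, `false` for `Y`), and `σ(Z)` is `!Z`.
They are defined by `[0]_Z = 0`, `[1]_Z = 1` and `[n+1]_Z = Z·[n]_{σ(Z)} − [n−1]_Z`. -/
noncomputable def TCQ.q : Bool → ℕ → TCQ.R₀
  | _, 0 => 0
  | _, 1 => 1
  | c, (n + 2) => MvPolynomial.X c * TCQ.q (!c) (n + 1) - TCQ.q c n

/-- `binom` is the two-colored quantum binomial coefficient
`[m choose n]_Z = ([m]_Z [m−1]_Z ⋯ [m−n+1]_Z)/([n]_Z [n−1]_Z ⋯ [1]_Z) ∈ ℤ[X,Y]`, i.e.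
it satisfies `[m choose n]_Z · ([n]_Z ⋯ [1]_Z) = [m]_Z ⋯ [m−n+1]_Z` for all `n ≤ m`
(this determines it uniquely, `ℤ[X,Y]` being a domain and the quantum numbers nonzero). -/
def TCQ.IsBinom (binom : Bool → ℕ → ℕ → TCQ.R₀) : Prop :=
  ∀ (Z : Bool) (m n : ℕ), n ≤ m →
    binom Z m n * ∏ i ∈ Finset.range n, TCQ.q Z (i + 1) = ∏ i ∈ Finset.range n, TCQ.q Z (m - i)

namespace TCQ

lemma q_add_two (c : Bool) (n : ℕ) :
    q c (n + 2) = MvPolynomial.X c * q (!c) (n + 1) - q c n := by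
  rw [q]

lemma eval_two_q (n : ℕ) (c : Bool) : MvPolynomial.eval (fun _ => (2 : ℤ)) (q c n) = n := by
  induction n using Nat.twoStepInduction generalizing c with
  | zero => simp [q]
  | one => simp [q]
  | more n ih₁ ih₂ =>
    simp only [q_add_two, map_sub, map_mul, MvPolynomial.eval_X, ih₁, ih₂]
    push_cast
    ring

lemma q_succ_ne_zero (c : Bool) (n : ℕ) : q c (n + 1) ≠ 0 := by
  intro h
  have h' := eval_two_q (n + 1) c
  rw [h, map_zero] at h'
  omega

/-- The recursion of the two-colored quantum numbers with the color kept fixed. -/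
lemma q_add_two_right (n : ℕ) (c : Bool) :
    q c (n + 2) = MvPolynomial.X (Bool.not^[n] c) * q c (n + 1) - q c n := by
  induction n using Nat.twoStepInduction generalizing c with
  | zero => simp [q]
  | one => simp [q]; ring
  | more n ih₁ ih₂ =>
    have h₁ := ih₁ c
    have h₂ := ih₂ (!c)
    simp only [Function.iterate_succ_apply, Bool.not_not] at h₁ h₂ ⊢
    linear_combination q_add_two c (n + 2) + MvPolynomial.X c * h₂ - h₁
      - MvPolynomial.X (Bool.not^[n] c) * q_add_two c (n + 1) + q_add_two c n

lemma q_eq_mul_sub_mul (k n : ℕ) (Z : Bool) :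
    q Z k = q (Bool.not^[n] Z) (n + k) * q Z (n + 1)
      - q Z n * q (Bool.not^[n + 1] Z) (n + k + 1) := by
  induction n with
  | zero => simp [q]
  | succ n ih =>
    have h := q_add_two (Bool.not^[n] Z) (n + k)
    simp only [Function.iterate_succ_apply', Bool.not_not] at ih ⊢
    rw [show n + 1 + k = n + k + 1 by ring]
    linear_combination ih - q (!(Bool.not^[n] Z)) (n + k + 1) * q_add_two_right n Z
      + q Z (n + 1) * h

lemma q_not_odd_and_even (j : ℕ) (c : Bool) :
    q (!c) (2 * j + 1) = q c (2 * j + 1) ∧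
      MvPolynomial.X (!c) * q c (2 * j) = MvPolynomial.X c * q (!c) (2 * j) := by
  induction j generalizing c with
  | zero => simp [q]
  | succ j ih =>
    have h : ∀ d : Bool, MvPolynomial.X (!d) * q d (2 * j + 2) =
        MvPolynomial.X d * q (!d) (2 * j + 2) := fun d => by
      have h₁ := q_add_two d (2 * j)
      have h₂ := q_add_two (!d) (2 * j)
      rw [Bool.not_not] at h₂
      linear_combination MvPolynomial.X (!d) * h₁ - MvPolynomial.X d * h₂ - (ih d).2
        + MvPolynomial.X (!d) * MvPolynomial.X d * (ih d).1
    refine ⟨?_, h c⟩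
    have h₁ := q_add_two c (2 * j + 1)
    have h₂ := q_add_two (!c) (2 * j + 1)
    rw [Bool.not_not] at h₂
    linear_combination h₂ - h₁ + h c - (ih c).1

lemma X_mul_q_mul_q_succ (a : ℕ) (c : Bool) :
    MvPolynomial.X (!c) * (q c a * q c (a + 1)) =
      MvPolynomial.X c * (q (!c) a * q (!c) (a + 1)) := by
  obtain ⟨j, rfl | rfl⟩ := Nat.even_or_odd' a
  · rw [(q_not_odd_and_even j c).1]
    linear_combination q c (2 * j + 1) * (q_not_odd_and_even j c).2
  · rw [(q_not_odd_and_even j c).1]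
    linear_combination q c (2 * j + 1) * (q_not_odd_and_even (j + 1) c).2

lemma X_pow_mul_prod_q (s : ℕ → ℕ) (c : Bool) (j : ℕ)
    (hs : ∀ i < j, s (2 * i) = s (2 * i + 1) + 1 ∨ s (2 * i + 1) = s (2 * i) + 1) :
    MvPolynomial.X (!c) ^ j * ∏ i ∈ Finset.range (2 * j), q c (s i) =
      MvPolynomial.X c ^ j * ∏ i ∈ Finset.range (2 * j), q (!c) (s i) := by
  induction j with
  | zero => simp
  | succ j ih =>
    have hpair : MvPolynomial.X (!c) * (q c (s (2 * j)) * q c (s (2 * j + 1))) =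
        MvPolynomial.X c * (q (!c) (s (2 * j)) * q (!c) (s (2 * j + 1))) := by
      obtain h | h := hs j j.lt_succ_self
      · rw [h]
        linear_combination X_mul_q_mul_q_succ (s (2 * j + 1)) c
      · rw [h]
        exact X_mul_q_mul_q_succ (s (2 * j)) c
    have h := congrArg₂ (· * ·) (ih fun i hi => hs i (by omega)) hpair
    rw [show 2 * (j + 1) = 2 * j + 1 + 1 by ring]
    simp only [Finset.prod_range_succ]
    linear_combination h

lemma prod_q_mul_prod_q_iterate_not (m k : ℕ) (hk : k ≤ m) (Z : Bool) :
    (∏ i ∈ Finset.range k, q (Bool.not^[k + 1] Z) (m - i)) *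
        ∏ i ∈ Finset.range (k + 1), q Z (i + 1) =
      (∏ i ∈ Finset.range k, q Z (m - i)) *
        ∏ i ∈ Finset.range (k + 1), q (Bool.not^[k + 1] Z) (i + 1) := by
  obtain ⟨j, rfl | rfl⟩ := Nat.even_or_odd' k
  · have hZ : Bool.not^[2 * j + 1] Z = !Z := by
      rw [Bool.involutive_not.iterate_odd (odd_two_mul_add_one j)]
    have h₁ := X_pow_mul_prod_q (fun i => m - i) Z j fun i hi => by omega
    have h₂ := X_pow_mul_prod_q (fun i => i + 1) Z j fun i hi => by omega
    rw [hZ]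
    simp only [Finset.prod_range_succ, (q_not_odd_and_even j Z).1]
    apply mul_left_cancel₀ (pow_ne_zero j (MvPolynomial.X_ne_zero (R := ℤ) Z))
    linear_combination q Z (2 * j + 1) * (∏ i ∈ Finset.range (2 * j), q Z (m - i)) * h₂
      - q Z (2 * j + 1) * (∏ i ∈ Finset.range (2 * j), q Z (i + 1)) * h₁
  · have hZ : Bool.not^[2 * j + 1 + 1] Z = Z := by
      rw [Bool.involutive_not.iterate_even (by grind), id]
    rw [hZ]

end TCQ

open TCQ in
/-- for `1 ≤ n ≤ m`,
`[m choose n]_Z = [m+1 choose n]_{σⁿ(Z)}·[n+1]_Z − [m choose n−1]_Z·[m+2]_{σ^{n+1}(Z)}`. -/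
theorem tcq_binom_inductive_formula₁ (binom : Bool → ℕ → ℕ → R₀) (hbinom : IsBinom binom)
    (m n : ℕ) (h1 : 1 ≤ n) (h2 : n ≤ m) (Z : Bool) :
    binom Z m n = binom (Bool.not^[n] Z) (m + 1) n * q Z (n + 1)
      - binom Z m (n - 1) * q (Bool.not^[n + 1] Z) (m + 2) := by
  obtain ⟨k, rfl⟩ := Nat.exists_eq_add_of_le' h1
  have hprod_ne (c : Bool) : ∏ i ∈ Finset.range (k + 1), q c (i + 1) ≠ 0 :=
    Finset.prod_ne_zero_iff.2 fun i _ => q_succ_ne_zero c i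
  have hfact := Finset.prod_range_succ (fun i => q Z (i + 1)) k
  have hb₁ := hbinom Z m (k + 1) h2
  rw [Finset.prod_range_succ (fun i => q Z (m - i))] at hb₁
  have hb₂ := hbinom (Bool.not^[k + 1] Z) (m + 1) (k + 1) (by omega)
  rw [Finset.prod_range_succ' (fun i => q _ (m + 1 - i))] at hb₂
  simp only [Nat.add_sub_add_right, Nat.sub_zero] at hb₂
  have hb₃ := hbinom Z m k (by omega)
  have hcross := prod_q_mul_prod_q_iterate_not m k (by omega) Z
  have hq := q_eq_mul_sub_mul (m - k) (k + 1) Z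
  rw [show k + 1 + (m - k) = m + 1 by omega] at hq
  rw [Nat.add_sub_cancel]
  have hne := hprod_ne Z
  have hne' := hprod_ne (Bool.not^[k + 1] Z)
  set W := Bool.not^[k + 1] Z
  set F := ∏ i ∈ Finset.range (k + 1), q Z (i + 1)
  set F' := ∏ i ∈ Finset.range (k + 1), q W (i + 1)
  set A := ∏ i ∈ Finset.range k, q Z (m - i)
  set V := Bool.not^[k + 1 + 1] Z
  apply mul_right_cancel₀ (mul_ne_zero hne hne')
  linear_combination F' * hb₁ + A * F' * hq - q Z (k + 1 + 1) * F * hb₂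
    - q W (m + 1) * q Z (k + 1 + 1) * hcross
    + q V (m + 2) * F' * (binom Z m k * hfact + q Z (k + 1) * hb₃)
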